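/- The orbit equivalence relation for regular {0,1}-Toeplitz subshifts is not smooth: letting S be the set of those nonempty compact subsets of Bool^ℤ that are regular Toeplitz subshifts (a subset of the space of nonempty compact subsets of Bool^ℤ with the Hausdorff metric, carrying the subspace Borel structure), there is no Borel measurable map f : S → (ℕ → Bool) such that for all X, Y ∈ S, the systems (X,σ) and (Y,σ) are orbit equivalent if and only if f(X) = f(Y). -/

import Mathlib

open MeasureTheory TopologicalSpace Topology

abbrev Cantor : Type := ℤ → Bool

def zOrbit {X : Type*} (φ : X → X) (x : X) : Set X :=
  {y | ∃ n : ℕ, φ^[n] x = y ∨ φ^[n] y = x}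

def shift {A : Type*} : (ℤ → A) → (ℤ → A) := fun x n => x (n + 1)

def IsToeplitz {A : Type*} (x : ℤ → A) : Prop :=
  ∀ k : ℤ, ∃ p : ℕ, 1 ≤ p ∧ ∀ n : ℤ, x (k + n * p) = x k

noncomputable def toeplitzDelta {A : Type*} (x : ℤ → A) (p : ℕ) : ℝ :=
  ({k : ℤ | 0 ≤ k ∧ k < (p : ℤ) ∧ ∀ n : ℤ, x (k + n * p) = x k}.ncard : ℝ) / p

def IsRegularToeplitz {A : Type*} (x : ℤ → A) : Prop :=
  IsToeplitz x ∧ sSup {d : ℝ | ∃ p : ℕ, 1 ≤ p ∧ d = toeplitzDelta x p} = 1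

def IsRegularToeplitzSubshift {A : Type*} [TopologicalSpace A] (X : Set (ℤ → A)) : Prop :=
  ∃ x : ℤ → A, IsRegularToeplitz x ∧ X = closure (zOrbit shift x)

def SubshiftOrbitEquivalent {A B : Type*} [TopologicalSpace A] [TopologicalSpace B]
    (X : Set (ℤ → A)) (Y : Set (ℤ → B)) : Prop :=
  ∃ f : X ≃ₜ Y, ∀ x y : X,
    (y : ℤ → A) ∈ zOrbit shift (x : ℤ → A) ↔
      ((f y : ℤ → B) ∈ zOrbit shift (f x : ℤ → B))

noncomputable instance : MetricSpace Cantor := TopologicalSpace.metrizableSpaceMetric Cantor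
noncomputable instance : MeasurableSpace (NonemptyCompacts Cantor) := borel _
instance : BorelSpace (NonemptyCompacts Cantor) := ⟨rfl⟩

/-- Those nonempty compact subsets of `Bool^ℤ` that are regular Toeplitz subshifts. -/
def RegToeplitz : Set (NonemptyCompacts Cantor) :=
  {X | IsRegularToeplitzSubshift (X : Set Cantor)}

/-! ### Exact divisibility by powers of two in the 2-adic integers -/

/-- `z` is divisible by `2 ^ n` but not by `2 ^ (n + 1)`. -/
def ExactPow (n : ℕ) (z : ℤ_[2]) : Prop := 2 ^ n ∣ z ∧ ¬ 2 ^ (n + 1) ∣ z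

lemma ExactPow.eq {m n : ℕ} {z : ℤ_[2]} (hm : ExactPow m z) (hn : ExactPow n z) : m = n := by
  by_contra hne
  rcases Nat.lt_or_gt_of_ne hne with h | h
  · exact hm.2 ((pow_dvd_pow 2 h).trans hn.1)
  · exact hn.2 ((pow_dvd_pow 2 h).trans hm.1)

lemma padicInt_two_pow_ne_zero (n : ℕ) : (2 : ℤ_[2]) ^ n ≠ 0 := pow_ne_zero _ two_ne_zero

lemma exactPow_two_pow (n : ℕ) : ExactPow n (2 ^ n) := by
  refine ⟨dvd_rfl, fun h => ?_⟩
  obtain ⟨w, hw⟩ := h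
  refine PadicInt.prime_p.not_isUnit (p := 2) (IsUnit.of_mul_eq_one w ?_)
  refine mul_left_cancel₀ (padicInt_two_pow_ne_zero n) ?_
  linear_combination -hw

lemma exactPow_valuation {z : ℤ_[2]} (hz : z ≠ 0) : ExactPow z.valuation z := by
  have h (n : ℕ) : 2 ^ n ∣ z ↔ n ≤ z.valuation := by
    have := PadicInt.mem_span_pow_iff_le_valuation z hz n
    rwa [Ideal.mem_span_singleton] at this
  exact ⟨(h _).2 le_rfl, fun h' => by have := (h _).1 h'; omega⟩

lemma ExactPow.ne_zero {n : ℕ} {z : ℤ_[2]} (h : ExactPow n z) : z ≠ 0 := by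
  rintro rfl
  exact h.2 (dvd_zero _)

lemma ExactPow.valuation_eq {n : ℕ} {z : ℤ_[2]} (h : ExactPow n z) : z.valuation = n :=
  (exactPow_valuation h.ne_zero).eq h

lemma ExactPow.add {n : ℕ} {z w : ℤ_[2]} (hz : ExactPow n z) (hw : 2 ^ (n + 1) ∣ w) :
    ExactPow n (z + w) :=
  ⟨dvd_add hz.1 ((pow_dvd_pow 2 n.le_succ).trans hw), fun h => hz.2 ((dvd_add_left hw).1 h)⟩

lemma ExactPow.two_mul {n : ℕ} {z : ℤ_[2]} (hz : ExactPow n z) : ExactPow (n + 1) (2 * z) := by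
  refine ⟨?_, fun h => hz.2 ?_⟩
  · rw [pow_succ']
    exact mul_dvd_mul_left _ hz.1
  · rw [pow_succ'] at h
    exact (mul_dvd_mul_iff_left two_ne_zero).1 h

lemma isClopen_two_pow_dvd (n : ℕ) : IsClopen {z : ℤ_[2] | 2 ^ n ∣ z} := by
  have h : {z : ℤ_[2] | 2 ^ n ∣ z} = Metric.closedBall 0 ((2 : ℝ) ^ (-n : ℤ)) := by
    ext z
    have := PadicInt.norm_le_pow_iff_mem_span_pow z n
    rw [Ideal.mem_span_singleton] at this
    simpa using this.symm
  rw [h]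
  exact IsUltrametricDist.isClopen_closedBall _ (by positivity)

lemma isClopen_exactPow (n : ℕ) : IsClopen {z : ℤ_[2] | ExactPow n z} :=
  (isClopen_two_pow_dvd n).inter (isClopen_two_pow_dvd (n + 1)).compl

lemma exists_nat_two_pow_dvd_sub (z : ℤ_[2]) (n : ℕ) : ∃ k : ℕ, 2 ^ n ∣ z - k :=
  ⟨z.appr n, by simpa [Ideal.mem_span_singleton] using PadicInt.appr_spec n z⟩

lemma two_dvd_or_two_dvd_add_one (z : ℤ_[2]) : 2 ∣ z ∨ 2 ∣ z + 1 := by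
  obtain ⟨k, hk⟩ := exists_nat_two_pow_dvd_sub z 1
  rw [pow_one] at hk
  rcases Nat.even_or_odd' k with ⟨l, rfl | rfl⟩
  · left
    have := dvd_add hk (dvd_mul_right (2 : ℤ_[2]) l)
    push_cast at this
    simpa using this
  · right
    have := dvd_add hk (dvd_mul_right (2 : ℤ_[2]) (l + 1))
    push_cast at this
    convert this using 1
    ring

lemma not_two_dvd_one_padicInt : ¬ (2 : ℤ_[2]) ∣ 1 := by
  simpa using (exactPow_two_pow 0).2

lemma exactPow_zero_of_two_dvd_add_one {z : ℤ_[2]} (h : 2 ∣ z + 1) : ExactPow 0 z := by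
  refine ⟨by simp, fun h' => not_two_dvd_one_padicInt ?_⟩
  rw [zero_add, pow_one] at h'
  exact (dvd_add_right h').1 h

/-! ### The hulls -/

/-- Along the address `t`, the symbol of `y` at `k` is `a n` whenever `2 ^ n` divides `k + t`
exactly. -/
def Fits (a : ℕ → Bool) (t : ℤ_[2]) (y : Cantor) : Prop :=
  ∀ (k : ℤ) (n : ℕ), ExactPow n (k + t) → y k = a n

/-- All sequences that fit `a` along some 2-adic address. -/
def toeplitzHull (a : ℕ → Bool) : Set Cantor := {y | ∃ t, Fits a t y}

open Classical in
/-- The sequence fitting `a` along `t` whose hole, if there is one, is filled with `c`. -/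
noncomputable def toeplitzPoint (c : Bool) (t : ℤ_[2]) (a : ℕ → Bool) : Cantor :=
  fun k => if (k : ℤ_[2]) + t = 0 then c else a ((k : ℤ_[2]) + t).valuation

lemma fits_toeplitzPoint (c : Bool) (t : ℤ_[2]) (a : ℕ → Bool) :
    Fits a t (toeplitzPoint c t a) := by
  intro k n h
  rw [toeplitzPoint, if_neg h.ne_zero, h.valuation_eq]

lemma Fits.exists_eq {a : ℕ → Bool} {t : ℤ_[2]} {y : Cantor} (h : Fits a t y) :
    ∃ c, y = toeplitzPoint c t a := by
  by_cases hk : ∃ k : ℤ, (k : ℤ_[2]) + t = 0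
  · obtain ⟨k, hk⟩ := hk
    refine ⟨y k, funext fun l => ?_⟩
    by_cases hl : (l : ℤ_[2]) + t = 0
    · have : l = k := by
        have h' := hl.trans hk.symm
        exact_mod_cast add_right_cancel h'
      rw [toeplitzPoint, if_pos hl, this]
    · rw [toeplitzPoint, if_neg hl]
      exact h l _ (exactPow_valuation hl)
  · push Not at hk
    refine ⟨false, funext fun l => ?_⟩
    rw [toeplitzPoint, if_neg (hk l)]
    exact h l _ (exactPow_valuation (hk l))

lemma Fits.translate {a : ℕ → Bool} {t : ℤ_[2]} {y : Cantor} (h : Fits a t y) (j : ℤ) :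
    Fits a (t + j) (fun k => y (k + j)) := by
  intro k n hn
  refine h (k + j) n ?_
  convert hn using 1
  push_cast
  ring

lemma isClosed_fits : IsClosed {p : (ℕ → Bool) × ℤ_[2] × Cantor | Fits p.1 p.2.1 p.2.2} := by
  simp only [Fits, Set.ofPred_forall]
  refine isClosed_iInter fun k => isClosed_iInter fun n => isClosed_imp ?_ ?_
  · exact (isClopen_exactPow n).isOpen.preimage
      (f := fun p : (ℕ → Bool) × ℤ_[2] × Cantor => (k : ℤ_[2]) + p.2.1) (by fun_prop)
  · exact isClosed_eq (by fun_prop) (by fun_prop)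

lemma isClosed_graph_toeplitzHull :
    IsClosed {p : (ℕ → Bool) × Cantor | p.2 ∈ toeplitzHull p.1} := by
  have h : IsClosed {p : ℤ_[2] × ((ℕ → Bool) × Cantor) | Fits p.2.1 p.1 p.2.2} :=
    isClosed_fits.preimage
      (f := fun p : ℤ_[2] × ((ℕ → Bool) × Cantor) => (p.2.1, p.1, p.2.2)) (by fun_prop)
  convert isClosedMap_snd_of_compactSpace _ h using 1
  ext p
  simp [toeplitzHull]

lemma isClosed_toeplitzHull (a : ℕ → Bool) : IsClosed (toeplitzHull a) :=
  isClosed_graph_toeplitzHull.preimage (f := fun y : Cantor => (a, y)) (by fun_prop)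

/-- The hull as a point of the hyperspace. -/
def toeplitzCompacts (a : ℕ → Bool) : NonemptyCompacts Cantor where
  carrier := toeplitzHull a
  isCompact' := (isClosed_toeplitzHull a).isCompact
  nonempty' := ⟨_, 0, fits_toeplitzPoint false 0 a⟩

lemma continuous_toeplitzPoint (c : Bool) (t : ℤ_[2]) : Continuous (toeplitzPoint c t) := by
  refine continuous_pi fun k => ?_
  unfold toeplitzPoint
  split_ifs <;> fun_prop

attribute [local instance] TopologicalSpace.vietoris in
lemma continuous_toeplitzCompacts : Continuous toeplitzCompacts := by
  rw [NonemptyCompacts.isEmbedding_coe.continuous_iff, vietoris.continuous_iff]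
  refine ⟨fun U hU => ?_, fun F hF => ?_⟩
  · have h : IsClosed {p : (ℕ → Bool) × Cantor | p.2 ∈ toeplitzHull p.1 ∧ p.2 ∈ Uᶜ} :=
      isClosed_graph_toeplitzHull.inter (hU.isClosed_compl.preimage continuous_snd)
    convert (isClosedMap_fst_of_compactSpace _ h).isOpen_compl using 1
    ext a
    simp only [Set.mem_preimage, Function.comp_apply, Set.mem_powerset_iff, Set.mem_compl_iff,
      Set.mem_image, Set.mem_ofPred_eq, Prod.exists, exists_and_right, exists_eq_right, not_exists,
      not_and, not_not]
    exact Iff.rfl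
  · have h : IsOpen (⋃ (c : Bool) (t : ℤ_[2]), toeplitzPoint c t ⁻¹' Fᶜ) :=
      isOpen_iUnion fun c => isOpen_iUnion fun t =>
        hF.isOpen_compl.preimage (continuous_toeplitzPoint c t)
    convert h.isClosed_compl using 1
    ext a
    simp only [toeplitzCompacts, Set.mem_preimage, Function.comp_apply, Set.mem_powerset_iff,
      Set.mem_compl_iff, Set.mem_iUnion, not_exists, not_not]
    refine ⟨fun h c t => h ⟨t, fits_toeplitzPoint c t a⟩, ?_⟩
    rintro h y ⟨t, ht⟩
    obtain ⟨c, rfl⟩ := ht.exists_eq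
    exact h c t

/-! ### Orbits under the shift -/

lemma iterate_shift {A : Type*} (n : ℕ) (x : ℤ → A) : shift^[n] x = fun k => x (k + n) := by
  induction n generalizing x with
  | zero => simp
  | succ n ih =>
    rw [Function.iterate_succ_apply, ih]
    funext k
    simp only [shift]
    congr 1
    push_cast
    ring

lemma mem_zOrbit_shift {A : Type*} {x y : ℤ → A} :
    y ∈ zOrbit shift x ↔ ∃ j : ℤ, y = fun k => x (k + j) := by
  constructor
  · rintro ⟨n, h | h⟩
    · exact ⟨n, by rw [← h, iterate_shift]⟩
    · refine ⟨-n, ?_⟩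
      rw [← h, iterate_shift]
      simp
  · rintro ⟨j, rfl⟩
    obtain ⟨n, rfl | rfl⟩ := j.eq_nat_or_neg
    · exact ⟨n, Or.inl (iterate_shift n x)⟩
    · refine ⟨n, Or.inr ?_⟩
      rw [iterate_shift]
      simp

/-! ### Hulls of oscillating sequences are regular Toeplitz subshifts -/

/-- No symbol of `a` is repeated forever. -/
def Oscillating (a : ℕ → Bool) : Prop := ∀ n, ∃ m, n < m ∧ a m ≠ a n

lemma Oscillating.exists_eq {a : ℕ → Bool} (ha : Oscillating a) (c : Bool) (n : ℕ) :
    ∃ m, n ≤ m ∧ a m = c := by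
  by_cases h : a n = c
  · exact ⟨n, le_rfl, h⟩
  · obtain ⟨m, hm, hne⟩ := ha n
    refine ⟨m, hm.le, ?_⟩
    revert h hne
    cases a n <;> cases a m <;> cases c <;> simp

lemma exists_padicInt_ne_intCast : ∃ θ : ℤ_[2], ∀ k : ℤ, (k : ℤ_[2]) + θ ≠ 0 := by
  have h3 : IsUnit (3 : ℤ_[2]) := by
    have h : IsCoprime (3 : ℤ) 2 := ⟨1, -1, by norm_num⟩
    have := (PadicInt.isUnit_iff (p := 2) (z := ((3 : ℤ) : ℤ_[2]))).2 <|
      le_antisymm (PadicInt.norm_le_one _) <| not_lt.1 fun h => by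
        rw [PadicInt.norm_intCast_lt_one_iff] at h
        omega
    simpa using this
  obtain ⟨u, hu⟩ := h3.exists_right_inv
  refine ⟨u, fun k hk => ?_⟩
  have h : ((3 * k + 1 : ℤ) : ℤ_[2]) = 0 := by
    push_cast
    linear_combination 3 * hk - hu
  rw [Int.cast_eq_zero] at h
  omega

lemma closure_zOrbit_toeplitzPoint {a : ℕ → Bool} (ha : Oscillating a) (c : Bool) (θ : ℤ_[2]) :
    closure (zOrbit shift (toeplitzPoint c θ a)) = toeplitzHull a := by
  refine (closure_minimal ?_ (isClosed_toeplitzHull a)).antisymm ?_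
  · intro y hy
    obtain ⟨j, rfl⟩ := mem_zOrbit_shift.1 hy
    exact ⟨_, (fits_toeplitzPoint c θ a).translate j⟩
  · rintro y ⟨t, ht⟩
    obtain ⟨d, rfl⟩ := ht.exists_eq
    rw [mem_closure_iff]
    intro O hO hy
    obtain ⟨I, u, hI, hu⟩ := isOpen_pi_iff.1 hO _ hy
    obtain ⟨M, hM⟩ : ∃ M, ∀ k ∈ I, ((k : ℤ_[2]) + t).valuation < M := by
      refine ⟨I.sup (fun k => ((k : ℤ_[2]) + t).valuation) + 1, fun k hk => ?_⟩
      exact Nat.lt_succ_of_le (Finset.le_sup (f := fun k : ℤ => ((k : ℤ_[2]) + t).valuation) hk)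
    obtain ⟨n, hMn, hn⟩ := ha.exists_eq d M
    obtain ⟨j, w, hw⟩ := exists_nat_two_pow_dvd_sub (t + 2 ^ n - θ) (n + 1)
    refine ⟨fun k => toeplitzPoint c θ a (k + (j : ℤ)), hu fun k hk => ?_, mem_zOrbit_shift.2 ⟨j, rfl⟩⟩
    suffices h : toeplitzPoint c θ a (k + (j : ℤ)) = toeplitzPoint d t a k by
      simpa only [h] using (hI k hk).2
    have hfit := fits_toeplitzPoint c θ a (k + (j : ℤ))
    by_cases hk0 : (k : ℤ_[2]) + t = 0
    · rw [show toeplitzPoint d t a k = d from if_pos hk0, ← hn]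
      refine hfit n ?_
      convert (exactPow_two_pow n).add (w := 2 ^ (n + 1) * (-w)) (dvd_mul_right _ _) using 1
      push_cast
      linear_combination hk0 - hw
    · rw [show toeplitzPoint d t a k = a _ from if_neg hk0]
      have hlt := hM k hk
      refine hfit _ ?_
      convert (exactPow_valuation hk0).add (w := 2 ^ n + 2 ^ (n + 1) * (-w))
        (dvd_add (pow_dvd_pow 2 (by omega)) ((pow_dvd_pow 2 (by omega)).mul_right _)) using 1
      push_cast
      linear_combination - hw

lemma ExactPow.toeplitzPoint_periodic {c : Bool} {θ : ℤ_[2]} {a : ℕ → Bool} {k : ℤ} {m n : ℕ}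
    (h : ExactPow n (k + θ)) (hmn : n < m) (z : ℤ) :
    toeplitzPoint c θ a (k + z * (2 ^ m : ℕ)) = toeplitzPoint c θ a k := by
  rw [fits_toeplitzPoint c θ a k n h]
  refine fits_toeplitzPoint c θ a _ n ?_
  convert h.add (w := 2 ^ m * z) ((pow_dvd_pow 2 hmn).mul_right _) using 1
  push_cast
  ring

lemma int_eq_of_two_pow_dvd_add {θ : ℤ_[2]} {m : ℕ} {k l : ℤ} (hk : k ∈ Set.Ico 0 (2 ^ m : ℤ))
    (hl : l ∈ Set.Ico 0 (2 ^ m : ℤ)) (hk' : (2 : ℤ_[2]) ^ m ∣ k + θ) (hl' : 2 ^ m ∣ l + θ) :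
    k = l := by
  have h : (2 : ℤ_[2]) ^ m ∣ ((k - l : ℤ) : ℤ_[2]) := by
    push_cast
    simpa using dvd_sub hk' hl'
  have h' : ((2 : ℤ) ^ m) ∣ k - l := by
    have := (PadicInt.pow_p_dvd_int_iff (p := 2) m (k - l)).1 (by exact_mod_cast h)
    exact_mod_cast this
  obtain ⟨h1, h2⟩ := hk
  obtain ⟨h3, h4⟩ := hl
  have := Int.eq_zero_of_abs_lt_dvd h' (by rw [abs_lt]; constructor <;> linarith)
  linarith

lemma toeplitzDelta_le_one {A : Type*} (x : ℤ → A) (p : ℕ) : toeplitzDelta x p ≤ 1 := by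
  refine div_le_one_of_le₀ ?_ (Nat.cast_nonneg p)
  have h : {k : ℤ | 0 ≤ k ∧ k < (p : ℤ) ∧ ∀ n : ℤ, x (k + n * p) = x k}.ncard
      ≤ (Set.Ico 0 (p : ℤ)).ncard :=
    Set.ncard_le_ncard (fun k hk => ⟨hk.1, hk.2.1⟩) (Set.finite_Ico _ _)
  rw [← Finset.coe_Ico, Set.ncard_coe_finset, Int.card_Ico] at h
  exact_mod_cast (by simpa using h)

lemma le_toeplitzDelta_toeplitzPoint (c : Bool) (θ : ℤ_[2]) (a : ℕ → Bool) (m : ℕ) :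
    1 - (1 / 2 : ℝ) ^ m ≤ toeplitzDelta (toeplitzPoint c θ a) (2 ^ m) := by
  set P := {k : ℤ | 0 ≤ k ∧ k < ((2 ^ m : ℕ) : ℤ) ∧
    ∀ n : ℤ, toeplitzPoint c θ a (k + n * (2 ^ m : ℕ)) = toeplitzPoint c θ a k} with hP
  have hPfin : P.Finite := (Set.finite_Ico 0 ((2 ^ m : ℕ) : ℤ)).subset fun k hk => ⟨hk.1, hk.2.1⟩
  have hQ : (Set.Ico 0 (2 ^ m : ℤ) \ P).ncard ≤ 1 := by
    refine Set.ncard_le_one_iff_subsingleton.2 ?_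
    have key {k : ℤ} (hk : k ∈ Set.Ico 0 (2 ^ m : ℤ) \ P) : (2 : ℤ_[2]) ^ m ∣ k + θ := by
      by_cases h0 : (k : ℤ_[2]) + θ = 0
      · rw [h0]; exact dvd_zero _
      by_contra hdvd
      have hv := exactPow_valuation h0
      refine hk.2 ⟨hk.1.1, by exact_mod_cast hk.1.2, fun n => hv.toeplitzPoint_periodic ?_ n⟩
      by_contra hlt
      exact hdvd ((pow_dvd_pow 2 (not_lt.1 hlt)).trans hv.1)
    exact fun k hk l hl => int_eq_of_two_pow_dvd_add hk.1 hl.1 (key hk) (key hl)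
  have hcard : (Set.Ico 0 (2 ^ m : ℤ)).ncard = 2 ^ m := by
    rw [← Finset.coe_Ico, Set.ncard_coe_finset, Int.card_Ico, sub_zero]
    exact Int.toNat_natCast (2 ^ m)
  have hle : 2 ^ m ≤ P.ncard + 1 := by
    have := Set.ncard_le_ncard_sdiff_add_ncard (Set.Ico 0 (2 ^ m : ℤ)) P hPfin
    omega
  have hpos : (0 : ℝ) < 2 ^ m := by positivity
  rw [toeplitzDelta, ← hP, le_div_iff₀ (by push_cast; positivity)]
  have hle' : (2 : ℝ) ^ m ≤ P.ncard + 1 := by exact_mod_cast hle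
  push_cast
  rw [sub_mul, one_mul, ← mul_pow]
  norm_num
  linarith

lemma isRegularToeplitz_toeplitzPoint {θ : ℤ_[2]} (hθ : ∀ k : ℤ, (k : ℤ_[2]) + θ ≠ 0) (c : Bool)
    (a : ℕ → Bool) : IsRegularToeplitz (toeplitzPoint c θ a) := by
  refine ⟨fun k => ⟨2 ^ (((k : ℤ_[2]) + θ).valuation + 1), Nat.one_le_two_pow, fun n =>
    (exactPow_valuation (hθ k)).toeplitzPoint_periodic (Nat.lt_succ_self _) n⟩, ?_⟩
  have hbdd : ∀ d ∈ {d : ℝ | ∃ p : ℕ, 1 ≤ p ∧ d = toeplitzDelta (toeplitzPoint c θ a) p}, d ≤ 1 := by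
    rintro d ⟨p, -, rfl⟩
    exact toeplitzDelta_le_one _ _
  refine le_antisymm (csSup_le ⟨_, 1, le_rfl, rfl⟩ hbdd) ?_
  have hlim : Filter.Tendsto (fun m : ℕ => 1 - (1 / 2 : ℝ) ^ m) Filter.atTop (𝓝 1) := by
    simpa using (tendsto_pow_atTop_nhds_zero_of_lt_one (r := (1 / 2 : ℝ))
      (by norm_num) (by norm_num)).const_sub 1
  exact le_of_tendsto' hlim fun m => (le_toeplitzDelta_toeplitzPoint c θ a m).trans
    (le_csSup ⟨1, hbdd⟩ ⟨2 ^ m, Nat.one_le_two_pow, rfl⟩)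

lemma toeplitzCompacts_mem_regToeplitz {a : ℕ → Bool} (ha : Oscillating a) :
    toeplitzCompacts a ∈ RegToeplitz := by
  obtain ⟨θ, hθ⟩ := exists_padicInt_ne_intCast
  exact ⟨_, isRegularToeplitz_toeplitzPoint hθ false a,
    (closure_zOrbit_toeplitzPoint ha false θ).symm⟩

/-! ### Finite modifications give orbit equivalent hulls -/

lemma Fits.address_unique {a : ℕ → Bool} (ha : Oscillating a) {s t : ℤ_[2]} {y : Cantor}
    (hs : Fits a s y) (ht : Fits a t y) : s = t := by
  by_contra hne
  have hv := exactPow_valuation (sub_ne_zero.2 hne)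
  obtain ⟨n, hn, hne'⟩ := ha (s - t).valuation
  obtain ⟨k, w, hw⟩ := exists_nat_two_pow_dvd_sub (2 ^ n - t) (n + 1)
  have hk : ExactPow n ((k : ℤ) + t) := by
    convert (exactPow_two_pow n).add (w := 2 ^ (n + 1) * (-w)) (dvd_mul_right _ _) using 1
    push_cast
    linear_combination -hw
  have hk' : ExactPow (s - t).valuation ((k : ℤ) + s) := by
    convert hv.add (w := (k : ℤ) + t) ((pow_dvd_pow 2 hn).trans hk.1) using 1
    ring
  exact hne' ((ht k n hk).symm.trans (hs k _ hk'))

/-- `y` and `z` have the same address `t`, fit `a` and `b` respectively, and agree at the positions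
of level at least `m`. -/
def Linked (a b : ℕ → Bool) (m : ℕ) (t : ℤ_[2]) (y z : Cantor) : Prop :=
  Fits a t y ∧ Fits b t z ∧ ∀ k : ℤ, 2 ^ m ∣ (k : ℤ_[2]) + t → y k = z k

lemma Linked.symm {a b : ℕ → Bool} {m : ℕ} {t : ℤ_[2]} {y z : Cantor} (h : Linked a b m t y z) :
    Linked b a m t z y :=
  ⟨h.2.1, h.1, fun k hk => (h.2.2 k hk).symm⟩

lemma Linked.translate {a b : ℕ → Bool} {m : ℕ} {t : ℤ_[2]} {y z : Cantor}
    (h : Linked a b m t y z) (j : ℤ) :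
    Linked a b m (t + j) (fun k => y (k + j)) (fun k => z (k + j)) := by
  refine ⟨h.1.translate j, h.2.1.translate j, fun k hk => h.2.2 (k + j) ?_⟩
  convert hk using 1
  push_cast
  ring

lemma Linked.unique {a b : ℕ → Bool} (ha : Oscillating a) {m : ℕ} {s t : ℤ_[2]} {y z z' : Cantor}
    (h : Linked a b m s y z) (h' : Linked a b m t y z') : s = t ∧ z = z' := by
  obtain rfl := h.1.address_unique ha h'.1
  refine ⟨rfl, funext fun k => ?_⟩
  by_cases hk : 2 ^ m ∣ (k : ℤ_[2]) + s
  · rw [← h.2.2 k hk, h'.2.2 k hk]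
  · have hk0 : (k : ℤ_[2]) + s ≠ 0 := fun h0 => hk (h0 ▸ dvd_zero _)
    rw [h.2.1 k _ (exactPow_valuation hk0), h'.2.1 k _ (exactPow_valuation hk0)]

open Classical in
lemma Fits.exists_linked {a b : ℕ → Bool} {m : ℕ} (hab : ∀ n, m ≤ n → a n = b n) {t : ℤ_[2]}
    {y : Cantor} (h : Fits a t y) : ∃ z, Linked a b m t y z := by
  refine ⟨fun k => if 2 ^ m ∣ (k : ℤ_[2]) + t then y k else b ((k : ℤ_[2]) + t).valuation, h, ?_,
    fun k hk => by simp [hk]⟩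
  intro k n hn
  by_cases hk : 2 ^ m ∣ (k : ℤ_[2]) + t
  · simp only [hk, if_true]
    rw [h k n hn, hab]
    by_contra hlt
    exact hn.2 ((pow_dvd_pow 2 (by omega)).trans hk)
  · simp only [hk, if_false, hn.valuation_eq]

lemma isCompact_linked (a b : ℕ → Bool) (m : ℕ) :
    IsCompact {p : ℤ_[2] × Cantor × Cantor | Linked a b m p.1 p.2.1 p.2.2} := by
  have h : IsClosed {p : ℤ_[2] × Cantor × Cantor |
      ∀ k : ℤ, 2 ^ m ∣ (k : ℤ_[2]) + p.1 → p.2.1 k = p.2.2 k} := by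
    rw [Set.ofPred_forall]
    refine isClosed_iInter fun k => isClosed_imp ?_ ?_
    · exact (isClopen_two_pow_dvd m).isOpen.preimage
        (f := fun p : ℤ_[2] × Cantor × Cantor => (k : ℤ_[2]) + p.1) (by fun_prop)
    · exact isClosed_eq (by fun_prop) (by fun_prop)
  exact IsClosed.isCompact ((isClosed_fits.preimage
    (f := fun p : ℤ_[2] × Cantor × Cantor => (a, p.1, p.2.1)) (by fun_prop)).inter
    ((isClosed_fits.preimage
    (f := fun p : ℤ_[2] × Cantor × Cantor => (b, p.1, p.2.2)) (by fun_prop)).inter h))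

lemma exists_homeomorph_linked {a b : ℕ → Bool} (ha : Oscillating a) {m : ℕ}
    (hab : ∀ n, m ≤ n → a n = b n) :
    ∃ f : {p : ℤ_[2] × Cantor × Cantor | Linked a b m p.1 p.2.1 p.2.2} ≃ₜ toeplitzHull a,
      ∀ p, (f p : Cantor) = p.1.2.1 := by
  have := isCompact_iff_compactSpace.1 (isCompact_linked a b m)
  let g : {p : ℤ_[2] × Cantor × Cantor | Linked a b m p.1 p.2.1 p.2.2} → toeplitzHull a :=
    fun p => ⟨p.1.2.1, p.1.1, p.2.1⟩
  have hg : Function.Bijective g := by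
    refine ⟨?_, ?_⟩
    · rintro ⟨⟨s, y, z⟩, hp⟩ ⟨⟨t, y', z'⟩, hq⟩ h
      obtain rfl : y = y' := congrArg Subtype.val h
      obtain ⟨rfl, rfl⟩ := hp.unique ha hq
      rfl
    · rintro ⟨y, t, ht⟩
      obtain ⟨z, hz⟩ := ht.exists_linked hab
      exact ⟨⟨(t, y, z), hz⟩, rfl⟩
  have hcont : Continuous (Equiv.ofBijective g hg) :=
    Continuous.subtype_mk (by fun_prop) _
  exact ⟨hcont.homeoOfEquivCompactToT2, fun p => rfl⟩

lemma subshiftOrbitEquivalent_toeplitzHull {a b : ℕ → Bool} (ha : Oscillating a)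
    (hb : Oscillating b) {m : ℕ} (hab : ∀ n, m ≤ n → a n = b n) :
    SubshiftOrbitEquivalent (toeplitzHull a) (toeplitzHull b) := by
  obtain ⟨f, hf⟩ := exists_homeomorph_linked ha hab
  obtain ⟨g, hg⟩ := exists_homeomorph_linked hb (fun n hn => (hab n hn).symm)
  let e : {p : ℤ_[2] × Cantor × Cantor | Linked a b m p.1 p.2.1 p.2.2} ≃ₜ
      {p : ℤ_[2] × Cantor × Cantor | Linked b a m p.1 p.2.1 p.2.2} :=
    { toFun := fun p => ⟨(p.1.1, p.1.2.2, p.1.2.1), p.2.symm⟩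
      invFun := fun p => ⟨(p.1.1, p.1.2.2, p.1.2.1), p.2.symm⟩
      left_inv := fun _ => rfl
      right_inv := fun _ => rfl
      continuous_toFun := Continuous.subtype_mk (by fun_prop) _
      continuous_invFun := Continuous.subtype_mk (by fun_prop) _ }
  refine ⟨f.symm.trans (e.trans g), fun x y => ?_⟩
  obtain ⟨⟨⟨s, x, x'⟩, hp⟩, rfl⟩ := f.surjective x
  obtain ⟨⟨⟨t, y, y'⟩, hq⟩, rfl⟩ := f.surjective y
  simp only [Homeomorph.trans_apply, Homeomorph.symm_apply_apply, hf, hg, mem_zOrbit_shift]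
  refine exists_congr fun j => ⟨?_, ?_⟩
  · rintro rfl
    exact (hq.unique ha (hp.translate j)).2
  · intro h
    change y' = fun k => x' (k + j) at h
    subst h
    exact (hq.symm.unique hb (hp.translate j).symm).2

/-! ### Invariant measures on the hulls -/

/-- A bijection that moves every point by one of countably many measure preserving bijections is
measure preserving. -/
lemma measurePreserving_of_forall_exists_eq {X : Type*} [MeasurableSpace X] {μ : Measure X}
    {T : X ≃ᵐ X} {g : ℕ → X ≃ᵐ X} (hg : ∀ i, MeasurePreserving (g i) μ μ)
    (hmeas : ∀ i, MeasurableSet {x | T x = g i x}) (hT : ∀ x, ∃ i, T x = g i x) :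
    MeasurePreserving T μ μ := by
  set D := disjointed fun i => {x | T x = g i x} with hD
  have hDmeas : ∀ i, MeasurableSet (D i) := MeasurableSet.disjointed hmeas
  have hDdisj : Pairwise (Function.onFun Disjoint D) := disjoint_disjointed _
  have hDcover : ⋃ i, D i = Set.univ := by
    rw [hD, iUnion_disjointed]
    exact Set.eq_univ_of_forall fun x => Set.mem_iUnion.2 (hT x)
  have hDeq : ∀ i, ∀ x ∈ D i, T x = g i x := fun i x hx => disjointed_subset _ i hx
  have key : ∀ A, MeasurableSet A → μ (T '' A) = μ A := by
    intro A hA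
    have hA' : A = ⋃ i, A ∩ D i := by rw [← Set.inter_iUnion, hDcover, Set.inter_univ]
    have hAdisj : Pairwise (Function.onFun Disjoint fun i => A ∩ D i) := fun i j hij =>
      (hDdisj hij).mono Set.inter_subset_right Set.inter_subset_right
    conv_rhs => rw [hA', measure_iUnion hAdisj fun i => hA.inter (hDmeas i)]
    conv_lhs => rw [hA', Set.image_iUnion]
    rw [measure_iUnion]
    · refine tsum_congr fun i => ?_
      rw [Set.image_congr fun x hx => hDeq i x hx.2, ← (hg i).measure_preimage_equiv,
        Set.preimage_image_eq _ (g i).injective]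
    · exact fun i j hij => (Set.disjoint_image_iff T.injective).2 (hAdisj hij)
    · exact fun i => T.measurableSet_image.2 (hA.inter (hDmeas i))
  refine ⟨T.measurable, Measure.ext fun A hA => ?_⟩
  rw [T.map_apply, ← key _ (T.measurable hA), Set.image_preimage_eq _ T.surjective]

lemma continuous_translate (j : ℤ) : Continuous fun (x : Cantor) (k : ℤ) => x (k + j) :=
  continuous_pi fun _ => continuous_apply _

/-- Translation by `j` on a hull. -/
def hullShift (a : ℕ → Bool) (j : ℤ) : toeplitzHull a ≃ₜ toeplitzHull a where
  toFun y := ⟨fun k => y.1 (k + j), by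
    obtain ⟨t, ht⟩ := y.2
    exact ⟨_, ht.translate j⟩⟩
  invFun y := ⟨fun k => y.1 (k + -j), by
    obtain ⟨t, ht⟩ := y.2
    exact ⟨_, ht.translate (-j)⟩⟩
  left_inv y := by ext k; simp
  right_inv y := by ext k; simp
  continuous_toFun := ((continuous_translate j).comp continuous_subtype_val).subtype_mk _
  continuous_invFun := ((continuous_translate (-j)).comp continuous_subtype_val).subtype_mk _

/-- Invariance of a measure on a hull under all translations. -/
def HullInvariant {a : ℕ → Bool} (μ : Measure (toeplitzHull a)) : Prop :=
  ∀ j, MeasurePreserving (hullShift a j) μ μ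

lemma HullInvariant.map {a b : ℕ → Bool} {μ : Measure (toeplitzHull a)} (hμ : HullInvariant μ)
    (f : toeplitzHull a ≃ₜ toeplitzHull b)
    (hf : ∀ x y : toeplitzHull a, (y : Cantor) ∈ zOrbit shift (x : Cantor) ↔
      (f y : Cantor) ∈ zOrbit shift (f x : Cantor)) :
    HullInvariant (μ.map f) := by
  intro j
  let e : toeplitzHull a ≃ₜ toeplitzHull a := f.trans ((hullShift b j).trans f.symm)
  have he : MeasurePreserving e.toMeasurableEquiv μ μ := by
    refine measurePreserving_of_forall_exists_eq
      (g := fun i => (hullShift a ((Denumerable.eqv ℤ).symm i)).toMeasurableEquiv)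
      (fun i => hμ _) (fun i => ?_) fun x => ?_
    · exact (isClosed_eq e.continuous (hullShift a _).continuous).measurableSet
    · obtain ⟨i, hi⟩ := mem_zOrbit_shift.1 <| (hf x (e x)).2 <| mem_zOrbit_shift.2
        ⟨j, by simp [e, hullShift]⟩
      refine ⟨Denumerable.eqv ℤ i, Subtype.ext ?_⟩
      simpa [hullShift] using hi
  have hfμ : MeasurePreserving f μ (μ.map f) := f.measurable.measurePreserving μ
  have h := hfμ.comp he
  have hcomp : f ∘ e.toMeasurableEquiv = hullShift b j ∘ f := by
    ext x
    simp [e]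
  rw [hcomp] at h
  refine ⟨(hullShift b j).measurable, ?_⟩
  rw [Measure.map_map (hullShift b j).measurable f.measurable]
  exact h.map_eq

lemma measurable_valuation_add [MeasurableSpace ℤ_[2]] [BorelSpace ℤ_[2]] (z : ℤ_[2]) :
    Measurable fun t : ℤ_[2] => (z + t).valuation := by
  have h : Measurable (PadicInt.valuation : ℤ_[2] → ℕ) := by
    refine measurable_to_countable' fun n => ?_
    have h' : (PadicInt.valuation : ℤ_[2] → ℕ) ⁻¹' {n} =
        {z | ExactPow n z} ∪ {0} ∩ PadicInt.valuation ⁻¹' {n} := by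
      ext z
      by_cases hz : z = 0
      · subst hz
        simpa using fun h : ExactPow n 0 => (h.ne_zero rfl).elim
      · simp only [Set.mem_preimage, Set.mem_singleton_iff, Set.mem_union, Set.mem_ofPred_eq,
          Set.mem_inter_iff, hz, false_and, or_false]
        exact ⟨fun h => h ▸ exactPow_valuation hz, ExactPow.valuation_eq⟩
    rw [h']
    exact (isClopen_exactPow n).isClosed.measurableSet.union
      (Set.subsingleton_singleton.anti Set.inter_subset_left).measurableSet
  exact h.comp (measurable_const_add z)

lemma measurable_toeplitzPoint [MeasurableSpace ℤ_[2]] [BorelSpace ℤ_[2]] (c : Bool)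
    (a : ℕ → Bool) : Measurable fun t => toeplitzPoint c t a := by
  refine measurable_pi_lambda _ fun k => ?_
  refine Measurable.ite ?_ measurable_const
    ((measurable_of_countable a).comp (measurable_valuation_add _))
  exact (isClosed_eq (by fun_prop) (by fun_prop)).measurableSet

lemma exists_hullInvariant (a : ℕ → Bool) :
    ∃ μ : Measure (toeplitzHull a), IsProbabilityMeasure μ ∧ HullInvariant μ := by
  let : MeasurableSpace ℤ_[2] := borel _
  have : BorelSpace ℤ_[2] := ⟨rfl⟩
  let μ : Measure ℤ_[2] := Measure.addHaarMeasure ⊤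
  have hμ : IsProbabilityMeasure μ := ⟨Measure.addHaarMeasure_self⟩
  let φ : ℤ_[2] → toeplitzHull a := fun t =>
    ⟨toeplitzPoint false t a, t, fits_toeplitzPoint false t a⟩
  have hφ : Measurable φ := (measurable_toeplitzPoint false a).subtype_mk
  refine ⟨μ.map φ, Measure.isProbabilityMeasure_map hφ.aemeasurable, fun j =>
    ⟨(hullShift a j).measurable, ?_⟩⟩
  have hcomp : hullShift a j ∘ φ = φ ∘ fun t => t + j := by
    ext t k
    have : ((k + j : ℤ) : ℤ_[2]) + t = k + (t + j) := by push_cast; ring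
    simp only [hullShift, φ, toeplitzPoint, Function.comp_apply, Homeomorph.homeomorph_mk_coe,
      Equiv.coe_fn_mk, this]
    congr 2
  rw [Measure.map_map (hullShift a j).measurable hφ, hcomp,
    ← Measure.map_map hφ (measurable_add_const _), map_add_right_eq_self]

/-! ### Frequencies -/

/-- The number of symbols `1` at levels below `m` within a period `2 ^ m`. -/
def levelCount : ℕ → (ℕ → Bool) → ℕ
  | 0, _ => 0
  | m + 1, a => 2 ^ m * (a 0).toNat + levelCount m fun n => a (n + 1)

lemma levelCount_succ (m : ℕ) (a : ℕ → Bool) :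
    levelCount (m + 1) a = 2 * levelCount m a + (a m).toNat := by
  induction m generalizing a with
  | zero => simp [levelCount]
  | succ m ih =>
    rw [levelCount, ih, levelCount]
    ring

lemma sum_range_two_mul (f : ℕ → ℕ) (n : ℕ) :
    ∑ i ∈ Finset.range (2 * n), f i = ∑ i ∈ Finset.range n, (f (2 * i) + f (2 * i + 1)) := by
  induction n with
  | zero => simp
  | succ n ih =>
    rw [Finset.sum_range_succ, ← ih, show 2 * (n + 1) = 2 * n + 1 + 1 by ring,
      Finset.sum_range_succ, Finset.sum_range_succ, add_assoc]

lemma Fits.levelCount_le {a : ℕ → Bool} {t : ℤ_[2]} {y : Cantor} (h : Fits a t y) (m : ℕ) :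
    levelCount m a ≤ ∑ i ∈ Finset.range (2 ^ m), (y i).toNat ∧
      ∑ i ∈ Finset.range (2 ^ m), (y i).toNat ≤ levelCount m a + 1 := by
  induction m generalizing a t y with
  | zero => simpa [levelCount] using Bool.toNat_le (y 0)
  | succ m ih =>
    rw [pow_succ', sum_range_two_mul, Finset.sum_add_distrib, levelCount]
    rcases two_dvd_or_two_dvd_add_one t with ⟨s, rfl⟩ | ⟨s, hs⟩
    · have h1 : ∀ i : ℕ, y ((2 * i + 1 : ℕ) : ℤ) = a 0 := fun i => h _ 0 <| by
        refine exactPow_zero_of_two_dvd_add_one ⟨i + 1 + s, ?_⟩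
        push_cast
        ring
      have h2 : Fits (fun n => a (n + 1)) s (fun k => y (2 * k)) := fun k n hn => h _ _ <| by
        convert hn.two_mul using 1
        push_cast
        ring
      have := ih h2
      simp only [h1, Finset.sum_const, Finset.card_range, smul_eq_mul]
      push_cast
      omega
    · have h1 : ∀ i : ℕ, y ((2 * i : ℕ) : ℤ) = a 0 := fun i => h _ 0 <| by
        refine exactPow_zero_of_two_dvd_add_one ⟨i + s, ?_⟩
        push_cast
        linear_combination hs
      have h2 : Fits (fun n => a (n + 1)) s (fun k => y (2 * k + 1)) := fun k n hn => h _ _ <| by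
        convert hn.two_mul using 1
        push_cast
        linear_combination hs
      have := ih h2
      simp only [h1, Finset.sum_const, Finset.card_range, smul_eq_mul]
      push_cast
      omega

lemma HullInvariant.levelCount_le {a : ℕ → Bool} {μ : Measure (toeplitzHull a)}
    [IsProbabilityMeasure μ] (hμ : HullInvariant μ) (m : ℕ) :
    (levelCount m a : ENNReal) ≤ 2 ^ m * ∫⁻ y, ((y.1 0).toNat : ENNReal) ∂μ ∧
      2 ^ m * ∫⁻ y, ((y.1 0).toNat : ENNReal) ∂μ ≤ levelCount m a + 1 := by
  have hmeas (i : ℤ) : Measurable fun y : toeplitzHull a => ((y.1 i).toNat : ENNReal) :=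
    (measurable_of_countable fun b : Bool => (b.toNat : ENNReal)).comp
      ((measurable_pi_apply i).comp measurable_subtype_coe)
  have hint (i : ℤ) : ∫⁻ y, ((y.1 i).toNat : ENNReal) ∂μ = ∫⁻ y, ((y.1 0).toNat : ENNReal) ∂μ := by
    rw [← (hμ i).lintegral_comp (hmeas 0)]
    simp [hullShift]
  have hsum : 2 ^ m * ∫⁻ y, ((y.1 0).toNat : ENNReal) ∂μ =
      ∫⁻ y, ((∑ i ∈ Finset.range (2 ^ m), (y.1 (i : ℤ)).toNat : ℕ) : ENNReal) ∂μ := by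
    simp only [Nat.cast_sum]
    rw [lintegral_finsetSum _ fun (i : ℕ) _ => hmeas i]
    simp [hint]
  rw [hsum]
  have hbound (y : toeplitzHull a) := y.2.elim fun t ht => ht.levelCount_le m
  constructor
  · calc (levelCount m a : ENNReal) = ∫⁻ _, (levelCount m a : ENNReal) ∂μ := by simp
      _ ≤ _ := lintegral_mono fun y => Nat.cast_le.2 (hbound y).1
  · calc _ ≤ ∫⁻ _, ((levelCount m a + 1 : ℕ) : ENNReal) ∂μ :=
          lintegral_mono fun y => Nat.cast_le.2 (hbound y).2
      _ = _ := by simp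

lemma levelCount_le_of_orbitEquivalence {a b : ℕ → Bool} (f : toeplitzHull a ≃ₜ toeplitzHull b)
    (hf : ∀ x y : toeplitzHull a, (y : Cantor) ∈ zOrbit shift (x : Cantor) ↔
      (f y : Cantor) ∈ zOrbit shift (f x : Cantor))
    (h0 : ∀ y, (f y).1 0 = y.1 0) (m : ℕ) :
    levelCount m a ≤ levelCount m b + 1 ∧ levelCount m b ≤ levelCount m a + 1 := by
  obtain ⟨μ, hprob, hμ⟩ := exists_hullInvariant a
  have := Measure.isProbabilityMeasure_map (μ := μ) f.measurable.aemeasurable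
  have hν := (hμ.map f hf).levelCount_le m
  have hμm := hμ.levelCount_le m
  have hmeas : Measurable fun y : toeplitzHull b => ((y.1 0).toNat : ENNReal) :=
    (measurable_of_countable fun b : Bool => (b.toNat : ENNReal)).comp
      ((measurable_pi_apply 0).comp measurable_subtype_coe)
  rw [lintegral_map hmeas f.measurable] at hν
  simp only [h0] at hν
  exact ⟨by exact_mod_cast hμm.1.trans hν.2, by exact_mod_cast hν.1.trans hμm.2⟩

/-! ### Encoding -/

/-- Interleaving of a sequence with its negation. -/
def interleaveNot (a : ℕ → Bool) : ℕ → Bool := fun n => if n % 2 = 0 then a (n / 2) else !a (n / 2)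

lemma interleaveNot_two_mul (a : ℕ → Bool) (n : ℕ) : interleaveNot a (2 * n) = a n := by
  simp [interleaveNot]

lemma interleaveNot_two_mul_add_one (a : ℕ → Bool) (n : ℕ) :
    interleaveNot a (2 * n + 1) = !a n := by
  simp [interleaveNot, Nat.add_mod, show (2 * n + 1) / 2 = n by omega]

lemma continuous_interleaveNot : Continuous interleaveNot := by
  refine continuous_pi fun n => ?_
  by_cases h : n % 2 = 0
  · simpa only [interleaveNot, h, if_true] using continuous_apply (n / 2)
  · simp only [interleaveNot, h, if_false]
    exact (continuous_of_discreteTopology (f := Bool.not)).comp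
      (continuous_apply (A := fun _ : ℕ => Bool) (n / 2))

lemma oscillating_interleaveNot (a : ℕ → Bool) : Oscillating (interleaveNot a) := by
  intro n
  have h1 := interleaveNot_two_mul a (n + 1)
  have h2 := interleaveNot_two_mul_add_one a (n + 1)
  by_cases h : a (n + 1) = interleaveNot a n
  · exact ⟨2 * (n + 1) + 1, by omega, by rw [h2, h]; exact Bool.not_ne_self _⟩
  · exact ⟨2 * (n + 1), by omega, by rwa [h1]⟩

lemma levelCount_interleaveNot (a : ℕ → Bool) (n : ℕ) :
    levelCount (2 * (n + 1)) (interleaveNot a) =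
      4 * levelCount (2 * n) (interleaveNot a) + 1 + (a n).toNat := by
  rw [show 2 * (n + 1) = 2 * n + 1 + 1 by ring, levelCount_succ, levelCount_succ,
    interleaveNot_two_mul, interleaveNot_two_mul_add_one]
  cases a n <;> simp <;> ring

lemma eq_of_levelCount_le {a b : ℕ → Bool}
    (h : ∀ m, levelCount m (interleaveNot a) ≤ levelCount m (interleaveNot b) + 1 ∧
      levelCount m (interleaveNot b) ≤ levelCount m (interleaveNot a) + 1) : a = b := by
  have key (n : ℕ) : levelCount (2 * n) (interleaveNot a) = levelCount (2 * n) (interleaveNot b) := by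
    have h1 := h (2 * (n + 1))
    have ha := levelCount_interleaveNot a n
    have hb := levelCount_interleaveNot b n
    have hac := Bool.toNat_le (a n)
    have hbc := Bool.toNat_le (b n)
    have h2 := h (2 * (n + 1 + 1))
    have ha' := levelCount_interleaveNot a (n + 1)
    have hb' := levelCount_interleaveNot b (n + 1)
    have hac' := Bool.toNat_le (a (n + 1))
    have hbc' := Bool.toNat_le (b (n + 1))
    omega
  funext n
  have ha := levelCount_interleaveNot a n
  have hb := levelCount_interleaveNot b n
  rw [key, key] at ha
  cases ha' : a n <;> cases hb' : b n <;> simp_all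

/-! ### The zero-one law -/

open ProbabilityTheory Filter in
lemma measure_zero_or_one_of_eventuallyEq {μ : ℕ → Measure Bool} [∀ n, IsProbabilityMeasure (μ n)]
    {A : Set (ℕ → Bool)} (hA : MeasurableSet A)
    (h : ∀ a b : ℕ → Bool, a =ᶠ[atTop] b → (a ∈ A ↔ b ∈ A)) :
    Measure.infinitePi μ A = 0 ∨ Measure.infinitePi μ A = 1 := by
  have hind := (iIndepFun_infinitePi (P := μ) (X := fun _ x => x) fun _ => measurable_id).iIndep
  refine measure_zero_or_one_of_measurableSet_limsup_atTop
    (fun n => (measurable_pi_apply n).comap_le) hind ?_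
  rw [limsup_eq_iInf_iSup_of_nat, MeasurableSpace.measurableSet_iInf]
  intro n
  let φ : (ℕ → Bool) → ℕ → Bool := fun a i => if i < n then false else a i
  have hφ : @Measurable _ _ (⨆ i ≥ n, MeasurableSpace.comap (fun a : ℕ → Bool => a i) inferInstance)
      _ φ := by
    refine @measurable_pi_lambda _ _ _ (_) _ _ fun i => ?_
    by_cases hi : i < n
    · simp only [φ, hi, if_true]
      exact measurable_const
    · simp only [φ, hi, if_false]
      exact (comap_measurable _).mono (le_iSup₂_of_le i (not_lt.1 hi) le_rfl) le_rfl
  have hAφ : A = φ ⁻¹' A := by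
    ext a
    refine h a (φ a) (eventually_atTop.2 ⟨n, fun i hi => ?_⟩)
    simp [φ, not_lt.2 hi]
  rw [hAφ]
  exact hφ hA

/-- The fair coin measure. -/
noncomputable def coinMeasure : Measure (ℕ → Bool) :=
  Measure.infinitePi fun _ => (PMF.uniformOfFintype Bool).toMeasure

instance : IsProbabilityMeasure coinMeasure := by
  unfold coinMeasure
  infer_instance

instance : NullSingletonClass coinMeasure := by
  refine ⟨fun a => ?_⟩
  have h (n : ℕ) : coinMeasure {a} ≤ (2⁻¹ : ENNReal) ^ n := by
    calc coinMeasure {a} ≤ coinMeasure (Set.pi (Finset.range n) fun i => {a i}) :=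
          measure_mono (by simp +contextual [Set.mem_pi])
      _ = _ := by
        rw [coinMeasure, Measure.infinitePi_pi _ fun _ _ => measurableSet_singleton _]
        simp
  refine le_antisymm (ge_of_tendsto' (ENNReal.tendsto_pow_atTop_nhds_zero_of_lt_one ?_) h) bot_le
  simp

open Filter in
/-- A measurable function invariant under eventual equality has an uncountable fibre. -/
lemma exists_not_countable_fiber {F : (ℕ → Bool) → ℕ → Bool} (hF : Measurable F)
    (h : ∀ a b : ℕ → Bool, a =ᶠ[atTop] b → F a = F b) :
    ∃ c, ¬ {a | F a = c}.Countable := by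
  have h01 (n : ℕ) : ∃ e : Bool, ∀ᵐ a ∂coinMeasure, F a n = e := by
    have hmeas : MeasurableSet {a | F a n = true} :=
      (measurable_pi_apply n).comp hF (measurableSet_singleton true)
    rcases measure_zero_or_one_of_eventuallyEq (μ := fun _ => (PMF.uniformOfFintype Bool).toMeasure)
      hmeas fun a b hab => by simp [h a b hab] with h0 | h1
    · refine ⟨false, ?_⟩
      filter_upwards [measure_eq_zero_iff_ae_notMem.1 h0] with a ha
      simpa using ha
    · exact ⟨true, (prob_compl_eq_zero_iff hmeas).2 h1⟩
  choose c hc using h01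
  refine ⟨c, fun hcount => ?_⟩
  have h0 := measure_eq_zero_iff_ae_notMem.1 (hcount.measure_zero coinMeasure)
  obtain ⟨a, ha, hac⟩ := (h0.and (ae_all_iff.2 hc)).exists
  exact ha (funext hac)

lemma countable_of_subshiftOrbitEquivalent {C : Set (ℕ → Bool)}
    (hC : ∀ a ∈ C, ∀ b ∈ C, SubshiftOrbitEquivalent (toeplitzHull (interleaveNot a))
      (toeplitzHull (interleaveNot b))) : C.Countable := by
  rcases C.eq_empty_or_nonempty with rfl | ⟨a₀, ha₀⟩
  · exact Set.countable_empty
  have : CompactSpace (toeplitzHull (interleaveNot a₀)) :=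
    isCompact_iff_compactSpace.1 (isClosed_toeplitzHull _).isCompact
  have : Countable (Clopens (toeplitzHull (interleaveNot a₀))) :=
    Clopens.countable_iff_secondCountable.2 inferInstance
  choose f hf using fun b : C => hC b b.2 a₀ ha₀
  let U (b : C) : Clopens (toeplitzHull (interleaveNot a₀)) :=
    ⟨(fun y => ((f b).symm y).1 0) ⁻¹' {true}, (isClopen_discrete _).preimage <|
      (continuous_apply (0 : ℤ)).comp (continuous_subtype_val.comp (f b).symm.continuous)⟩
  refine (Function.Injective.countable (f := U) fun b b' hbb' => ?_).to_set
  have h0 (y) : ((f b).symm y).1 0 = ((f b').symm y).1 0 :=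
    Bool.eq_iff_iff.2 (SetLike.ext_iff.1 hbb' y)
  refine Subtype.ext (eq_of_levelCount_le fun m => ?_)
  refine levelCount_le_of_orbitEquivalence ((f b).trans (f b').symm) (fun x y => ?_) (fun y => ?_) m
  · rw [hf b, hf b']
    simp
  · simp [← h0]

theorem stmt16 :
    ¬ ∃ f : RegToeplitz → (ℕ → Bool), Measurable f ∧
      ∀ X Y : RegToeplitz,
        (SubshiftOrbitEquivalent ((X : NonemptyCompacts Cantor) : Set Cantor)
            ((Y : NonemptyCompacts Cantor) : Set Cantor) ↔ f X = f Y) := by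
  rintro ⟨f, hf, hfeq⟩
  let F (a : ℕ → Bool) : RegToeplitz :=
    ⟨toeplitzCompacts (interleaveNot a), toeplitzCompacts_mem_regToeplitz (oscillating_interleaveNot a)⟩
  have hF : Continuous F :=
    (continuous_toeplitzCompacts.comp continuous_interleaveNot).subtype_mk _
  obtain ⟨c, hc⟩ := exists_not_countable_fiber (F := f ∘ F) (hf.comp hF.measurable) fun a b hab => by
    obtain ⟨m, hm⟩ := Filter.eventually_atTop.1 hab
    refine (hfeq _ _).1 (subshiftOrbitEquivalent_toeplitzHull (oscillating_interleaveNot a)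
      (oscillating_interleaveNot b) (m := 2 * m) fun n hn => ?_)
    simp [interleaveNot, hm (n / 2) (by omega)]
  exact hc <| countable_of_subshiftOrbitEquivalent fun a ha b hb =>
    (hfeq (F a) (F b)).2 (ha.trans hb.symm)
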